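/- The finiteness result also holds for the modified game in which the lowest card beats the highest card: for every n ≥ 2 and every state (L, R) over the deck {1, …, n}, some final state is reachable from (L, R) under the modified move relation. -/

import Mathlib

/-- A game state: the hands of the left and right player. -/
abbrev WarState := List ℕ × List ℕ

/-- A state is final if one of the players has no cards. -/
def Final (s : WarState) : Prop := s.1 = [] ∨ s.2 = []

/-- In the modified game over the deck `{1, …, n}`, card `a` beats card `b` in
the usual order, except that the lowest card `1` beats the highest card `n`. -/
def Beats (n a b : ℕ) : Prop := (a = 1 ∧ b = n) ∨ (a > b ∧ ¬ (a = n ∧ b = 1))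

/-- The move relation of the modified one-suit game of War over `{1, …, n}`. -/
inductive MoveMod (n : ℕ) : WarState → WarState → Prop
  | leftOwnLast (a b : ℕ) (L R : List ℕ) (h : Beats n a b) :
      MoveMod n (a :: L, b :: R) (L ++ [a, b], R)
  | leftRivalLast (a b : ℕ) (L R : List ℕ) (h : Beats n a b) :
      MoveMod n (a :: L, b :: R) (L ++ [b, a], R)
  | rightOwnLast (a b : ℕ) (L R : List ℕ) (h : Beats n b a) :
      MoveMod n (a :: L, b :: R) (L, R ++ [a, b])
  | rightRivalLast (a b : ℕ) (L R : List ℕ) (h : Beats n b a) :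
      MoveMod n (a :: L, b :: R) (L, R ++ [b, a])

/-- Reachability in the modified game. -/
def ReachableMod (n : ℕ) : WarState → WarState → Prop :=
  Relation.ReflTransGen (MoveMod n)

/-- A state is over the deck `{1, …, n}`. -/
def OverDeck (n : ℕ) (s : WarState) : Prop := (s.1 ++ s.2).Perm (List.range' 1 n)

/-- The effect of a round: the Boolean argument chooses the order in which the cards go back
(left player's card first when `true`), the Boolean result tells whether the left player won. -/
noncomputable def warStep (n : ℕ) : WarState × Bool → WarState × Bool
  | ((a :: L, b :: R), o) =>
    open Classical in
    if Beats n a b then ((L ++ (if o then [a, b] else [b, a]), R), true)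
    else ((L, R ++ (if o then [a, b] else [b, a])), false)
  | (s, _) => (s, true)

/-- The states over the deck from which no final state is reachable. -/
def wanderingStates (n : ℕ) : Set WarState :=
  {s | OverDeck n s ∧ ¬ ∃ t, ReachableMod n s t ∧ Final t}

theorem Beats.not_symm {n a b : ℕ} (hab : a ≠ b) (h : Beats n a b) : ¬ Beats n b a := by
  unfold Beats at *
  omega

theorem beats_of_not_beats {n a b : ℕ} (hab : a ≠ b) (h : ¬ Beats n a b) : Beats n b a := by
  unfold Beats at *
  omega

theorem finite_overDeck (n : ℕ) : {s : WarState | OverDeck n s}.Finite := by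
  have hfin : ({l | l ∈ (List.range' 1 n).permutations} ×ˢ Set.Iic n : Set (List ℕ × ℕ)).Finite :=
    (List.finite_toSet _).prod (Set.finite_Iic n)
  refine Set.Finite.of_injOn (f := fun s : WarState => (s.1 ++ s.2, s.1.length)) ?_ ?_ hfin
  · intro s hs
    have hlen := List.Perm.length_eq hs
    simp only [List.length_append, List.length_range'] at hlen
    exact ⟨List.mem_permutations.2 hs, Set.mem_Iic.2 (show s.1.length ≤ n by omega)⟩
  · intro s _ t _ h
    simp only [Prod.mk.injEq] at h
    exact Prod.ext_iff.2 (List.append_inj h.1 h.2)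

theorem MoveMod.perm {n : ℕ} {s t : WarState} (h : MoveMod n s t) :
    (t.1 ++ t.2).Perm (s.1 ++ s.2) := by
  cases h <;> (rw [List.perm_iff_count]; intro c; simp [List.count_cons]; omega)

theorem MoveMod.mem_wanderingStates {n : ℕ} {s t : WarState} (h : MoveMod n s t)
    (hs : s ∈ wanderingStates n) : t ∈ wanderingStates n :=
  ⟨h.perm.trans hs.1, fun ⟨u, hu, hf⟩ => hs.2 ⟨u, .head h hu, hf⟩⟩

theorem exists_cons_of_mem_wanderingStates {n : ℕ} {s : WarState} (hs : s ∈ wanderingStates n) :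
    ∃ a L b R, s = (a :: L, b :: R) ∧ a ≠ b := by
  obtain ⟨_ | ⟨a, L⟩, _ | ⟨b, R⟩⟩ := s
  · exact absurd ⟨_, .refl, .inl rfl⟩ hs.2
  · exact absurd ⟨_, .refl, .inl rfl⟩ hs.2
  · exact absurd ⟨_, .refl, .inr rfl⟩ hs.2
  · have hnodup : ((a :: L) ++ (b :: R)).Nodup := hs.1.nodup_iff.2 List.nodup_range'
    refine ⟨a, L, b, R, rfl, ?_⟩
    rintro rfl
    simp at hnodup

theorem moveMod_warStep {n : ℕ} {s : WarState} (hs : s ∈ wanderingStates n) (o : Bool) :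
    MoveMod n s (warStep n (s, o)).1 := by
  obtain ⟨a, L, b, R, rfl, hab⟩ := exists_cons_of_mem_wanderingStates hs
  by_cases h : Beats n a b
  · cases o
    · simpa [warStep, h] using MoveMod.leftRivalLast a b L R h
    · simpa [warStep, h] using MoveMod.leftOwnLast a b L R h
  · have h' := beats_of_not_beats hab h
    cases o
    · simpa [warStep, h] using MoveMod.rightRivalLast a b L R h'
    · simpa [warStep, h] using MoveMod.rightOwnLast a b L R h'

theorem warStep_injOn (n : ℕ) :
    Set.InjOn (warStep n) (wanderingStates n ×ˢ (Set.univ : Set Bool)) := by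
  rintro ⟨s, o⟩ ⟨hs, -⟩ ⟨s', o'⟩ ⟨hs', -⟩ heq
  obtain ⟨a, L, b, R, rfl, hab⟩ := exists_cons_of_mem_wanderingStates hs
  obtain ⟨a', L', b', R', rfl, hab'⟩ := exists_cons_of_mem_wanderingStates hs'
  have key : ∀ {x y x' y' : ℕ} {l l' : List ℕ},
      l ++ [x, y] = l' ++ [x', y'] → l = l' ∧ x = x' ∧ y = y' := fun h => by
    simpa using List.append_inj' h rfl
  by_cases h : Beats n a b <;> by_cases h' : Beats n a' b' <;>
    simp only [warStep, h, h', if_true, if_false, Prod.mk.injEq, and_true, reduceCtorEq,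
      and_false] at heq
  · obtain ⟨h1, rfl⟩ := heq
    cases o <;> cases o' <;> obtain ⟨rfl, rfl, rfl⟩ := key h1
    · rfl
    · exact absurd h' (h.not_symm hab)
    · exact absurd h' (h.not_symm hab)
    · rfl
  · obtain ⟨rfl, h1⟩ := heq
    cases o <;> cases o' <;> obtain ⟨rfl, rfl, rfl⟩ := key h1
    · rfl
    · exact absurd (beats_of_not_beats hab h) h'
    · exact absurd (beats_of_not_beats hab h) h'
    · rfl

theorem exists_mem_wanderingStates_length_lt {n : ℕ} {t : WarState}
    (ht : t ∈ wanderingStates n) : ∃ s ∈ wanderingStates n, s.1.length < t.1.length := by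
  have hfin : (wanderingStates n ×ˢ (Set.univ : Set Bool)).Finite :=
    ((finite_overDeck n).subset fun _ hs => hs.1).prod Set.finite_univ
  have hmaps : Set.MapsTo (warStep n) (wanderingStates n ×ˢ (Set.univ : Set Bool))
      (wanderingStates n ×ˢ (Set.univ : Set Bool)) := fun p hp =>
    ⟨(moveMod_warStep hp.1 p.2).mem_wanderingStates hp.1, trivial⟩
  obtain ⟨⟨s, o⟩, ⟨hs, -⟩, hst⟩ :=
    ((hfin.injOn_iff_bijOn_of_mapsTo hmaps).1 (warStep_injOn n)).surjOn
      (show (t, true) ∈ wanderingStates n ×ˢ (Set.univ : Set Bool) from ⟨ht, trivial⟩)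
  refine ⟨s, hs, ?_⟩
  obtain ⟨a, L, b, R, rfl, -⟩ := exists_cons_of_mem_wanderingStates hs
  by_cases h : Beats n a b <;>
    simp only [warStep, h, if_true, if_false, Prod.mk.injEq, and_true, reduceCtorEq,
      and_false] at hst
  subst hst
  cases o <;> simp

theorem notMem_wanderingStates (n : ℕ) (s : WarState) : s ∉ wanderingStates n := by
  induction hk : s.1.length using Nat.strong_induction_on generalizing s with
  | _ k ih =>
    intro hs
    obtain ⟨t, ht, hlt⟩ := exists_mem_wanderingStates_length_lt hs
    exact ih _ (hk ▸ hlt) t rfl ht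

/-- The finiteness result also holds for the modified game in which the lowest
card beats the highest one: from any state over the deck `{1, …, n}` (with
`n ≥ 2`) some final state is reachable. -/
theorem war_modified_no_wandering_vertices (n : ℕ) (hn : 2 ≤ n) (s : WarState)
    (hs : OverDeck n s) : ∃ t : WarState, ReachableMod n s t ∧ Final t := by
  by_contra h
  exact notMem_wanderingStates n s ⟨hs, h⟩
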